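/- Let Γ ⊆ 𝔉_{{∧,¬}} (formulas built from letters using only ∧ and ¬). If Γ is {∧,¬}-consistent (there is no formula φ with both Γ ⊢_{{∧,¬}} φ and Γ ⊢_{{∧,¬}} ¬φ), then Γ is classically consistent (there is no formula φ with both Γ ⊢_c φ and Γ ⊢_c ¬φ; equivalently, Γ has a two-valued Boolean model). -/

import Mathlib

/-- The four propositional connectives. -/
inductive Conn : Type
  | conj | disj | impl | nega
deriving DecidableEq

/-- Propositional formulas over countably many letters `p₀, p₁, …`. -/
inductive PropForm : Type
  | var : ℕ → PropForm
  | and : PropForm → PropForm → PropForm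
  | or : PropForm → PropForm → PropForm
  | imp : PropForm → PropForm → PropForm
  | neg : PropForm → PropForm

/-- The set of connectives occurring in a formula. -/
def PropForm.conns : PropForm → Set Conn
  | .var _ => ∅
  | .and a b => insert .conj (a.conns ∪ b.conns)
  | .or a b => insert .disj (a.conns ∪ b.conns)
  | .imp a b => insert .impl (a.conns ∪ b.conns)
  | .neg a => insert .nega a.conns

/-- `φ ∈ 𝔉_F` : the formula `φ` uses only connectives belonging to the fragment `F`. -/
def InFrag (F : Set Conn) (φ : PropForm) : Prop := φ.conns ⊆ F

/-- Derivability `Γ ⊢_F φ` for the fragment `F`: the least relation closed under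
membership, monotonicity, cut, and the two directions of the rules
(R∧), (R∨), (R→), (R¬I), (R¬E) for the connectives in `F`. -/
inductive Deriv (F : Set Conn) : Set PropForm → PropForm → Prop
  | mem {Γ : Set PropForm} {φ : PropForm} : φ ∈ Γ → Deriv F Γ φ
  | mono {Γ : Set PropForm} {φ ψ : PropForm} : Deriv F Γ φ → Deriv F (insert ψ Γ) φ
  | cut {Γ Δ : Set PropForm} {φ ψ : PropForm} :
      Deriv F Γ φ → Deriv F (insert φ Δ) ψ → Deriv F (Γ ∪ Δ) ψ
  | andI {Γ : Set PropForm} {φ ψ : PropForm} :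
      Conn.conj ∈ F → Deriv F Γ φ → Deriv F Γ ψ → Deriv F Γ (.and φ ψ)
  | andE1 {Γ : Set PropForm} {φ ψ : PropForm} :
      Conn.conj ∈ F → Deriv F Γ (.and φ ψ) → Deriv F Γ φ
  | andE2 {Γ : Set PropForm} {φ ψ : PropForm} :
      Conn.conj ∈ F → Deriv F Γ (.and φ ψ) → Deriv F Γ ψ
  | orI {Γ : Set PropForm} {φ ψ χ : PropForm} :
      Conn.disj ∈ F → Deriv F (insert φ Γ) χ → Deriv F (insert ψ Γ) χ →
      Deriv F (insert (.or φ ψ) Γ) χ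
  | orE1 {Γ : Set PropForm} {φ ψ χ : PropForm} :
      Conn.disj ∈ F → Deriv F (insert (.or φ ψ) Γ) χ → Deriv F (insert φ Γ) χ
  | orE2 {Γ : Set PropForm} {φ ψ χ : PropForm} :
      Conn.disj ∈ F → Deriv F (insert (.or φ ψ) Γ) χ → Deriv F (insert ψ Γ) χ
  | impI {Γ : Set PropForm} {φ ψ : PropForm} :
      Conn.impl ∈ F → Deriv F (insert φ Γ) ψ → Deriv F Γ (.imp φ ψ)
  | impE {Γ : Set PropForm} {φ ψ : PropForm} :
      Conn.impl ∈ F → Deriv F Γ (.imp φ ψ) → Deriv F (insert φ Γ) ψ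
  | negI {Γ : Set PropForm} {φ ψ : PropForm} :
      Conn.nega ∈ F → Deriv F (insert φ Γ) ψ → Deriv F (insert φ Γ) (.neg ψ) →
      Deriv F Γ (.neg φ)
  | negE {Γ : Set PropForm} {φ ψ : PropForm} :
      Conn.nega ∈ F → Deriv F Γ φ → Deriv F Γ (.neg φ) → Deriv F Γ ψ

/-- An algebra interpreting the connectives on a carrier `V`. -/
structure Alg (V : Type) where
  and : V → V → V
  or : V → V → V
  imp : V → V → V
  neg : V → V

/-- The homomorphic extension of an assignment `v` of letters. -/
def Alg.eval {V : Type} (A : Alg V) (v : ℕ → V) : PropForm → V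
  | .var n => v n
  | .and a b => A.and (A.eval v a) (A.eval v b)
  | .or a b => A.or (A.eval v a) (A.eval v b)
  | .imp a b => A.imp (A.eval v a) (A.eval v b)
  | .neg a => A.neg (A.eval v a)

/-- Semantic consequence `Γ ⊨_{A,D} φ`. -/
def SemConseq {V : Type} (A : Alg V) (D : Set V) (Γ : Set PropForm) (φ : PropForm) : Prop :=
  ∀ v : ℕ → V, (∀ ψ ∈ Γ, A.eval v ψ ∈ D) → A.eval v φ ∈ D

/-- The fragment `F` has a finite semantics. -/
def HasFiniteSemantics (F : Set Conn) : Prop :=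
  ∃ (V : Type) (_ : Fintype V) (A : Alg V) (D : Set V),
    ∀ (Γ : Set PropForm) (φ : PropForm),
      (∀ ψ ∈ Γ, InFrag F ψ) → InFrag F φ →
      (Deriv F Γ φ ↔ SemConseq A D Γ φ)

/-- `φ ∨̇ ψ = (φ → ψ) → ψ`. -/
def dvee (a b : PropForm) : PropForm := .imp (.imp a b) b

/-- Left-associated iterated `∨̇` of a list of formulas. -/
def bigDvee : List PropForm → PropForm
  | [] => .var 0
  | a :: rest => rest.foldl dvee a

/-- Left-associated iterated `∨` of a list of formulas. -/
def bigOrF : List PropForm → PropForm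
  | [] => .var 0
  | a :: rest => rest.foldl PropForm.or a

/-- All pairs `(i, j)` with `1 ≤ i < j ≤ n+1`. -/
def pairs (n : ℕ) : List (ℕ × ℕ) :=
  (List.range' 2 n).flatMap fun j => (List.range' 1 (j - 1)).map fun i => (i, j)

/-- `α_n = ∨̇_{1 ≤ i < j ≤ n+1} (p_j → p_i)`. -/
def alphaImp (n : ℕ) : PropForm :=
  bigDvee ((pairs n).map fun p => .imp (.var p.2) (.var p.1))

/-- `α_n = ⋁_{1 ≤ i < j ≤ n+1} ¬¬(¬p_i ∨ p_j)`. -/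
def alphaOrNeg (n : ℕ) : PropForm :=
  bigOrF ((pairs n).map fun p => .neg (.neg (.or (.neg (.var p.1)) (.var p.2))))

/-- Two-valued Boolean evaluation. -/
def evalBool (v : ℕ → Bool) : PropForm → Bool
  | .var n => v n
  | .and a b => evalBool v a && evalBool v b
  | .or a b => evalBool v a || evalBool v b
  | .imp a b => !evalBool v a || evalBool v b
  | .neg a => !evalBool v a

/-- Classical (two-valued) consequence `Γ ⊢_c φ`. -/
def ClassConseq (Γ : Set PropForm) (φ : PropForm) : Prop :=
  ∀ v : ℕ → Bool, (∀ ψ ∈ Γ, evalBool v ψ = true) → evalBool v φ = true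

/-- The two-element Boolean algebra `𝟐`. -/
def alg2 : Alg Bool where
  and a b := a && b
  or a b := a || b
  imp a b := !a || b
  neg a := !a

/-- The three-element algebra `𝟑` on the chain `0 < 1/2 < 1` (coded as `0 < 1 < 2` in `Fin 3`),
with meet `min` and meet complement `¬0 = 1`, `¬(1/2) = ¬1 = 0` (its `or`/`imp` are those of the
3-element Heyting chain). -/
def alg3 : Alg (Fin 3) where
  and a b := min a b
  or a b := max a b
  imp a b := if a ≤ b then 2 else b
  neg a := if a = 0 then 2 else 0

/-- The `(n+1)`-element Heyting chain, coded on `Fin (n+1)` (so `k` codes the element `k+1`). -/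
def chainAlg (n : ℕ) : Alg (Fin (n + 1)) where
  and a b := min a b
  or a b := max a b
  imp a b := if a ≤ b then Fin.last n else b
  neg a := if a = 0 then Fin.last n else 0

/-- Derivability is monotone in the set of premises. -/
theorem Deriv.weaken {F : Set Conn} {Γ Δ : Set PropForm} {φ : PropForm}
    (h : Deriv F Γ φ) (hs : Γ ⊆ Δ) : Deriv F Δ φ := by
  have := Deriv.cut (Δ := Δ) h (.mem (Set.mem_insert _ _))
  rwa [Set.union_eq_self_of_subset_left hs] at this

theorem Deriv.cut_self {F : Set Conn} {Γ : Set PropForm} {φ ψ : PropForm}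
    (h : Deriv F Γ φ) (h' : Deriv F (insert φ Γ) ψ) : Deriv F Γ ψ := by
  simpa using h.cut h'

theorem Deriv.exists_finite_insert {F : Set Conn} {Γ : Set PropForm} {φ χ : PropForm}
    (h : ∃ s ⊆ insert φ Γ, s.Finite ∧ Deriv F s χ) :
    ∃ t ⊆ Γ, t.Finite ∧ Deriv F (insert φ t) χ := by
  obtain ⟨s, hs, hf, hd⟩ := h
  refine ⟨s \ {φ}, by simpa [Set.sdiff_subset_iff] using hs, hf.sdiff, hd.weaken ?_⟩
  simp

/-- Every derivation uses only finitely many premises. -/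
theorem Deriv.exists_finite {F : Set Conn} {Γ : Set PropForm} {φ : PropForm}
    (h : Deriv F Γ φ) : ∃ s ⊆ Γ, s.Finite ∧ Deriv F s φ := by
  induction h with
  | @mem Γ φ h => exact ⟨{φ}, by simpa using h, Set.finite_singleton φ, .mem rfl⟩
  | mono _ ih =>
    obtain ⟨s, hs, hf, hd⟩ := ih
    exact ⟨s, hs.trans (Set.subset_insert _ _), hf, hd⟩
  | cut _ _ ih₁ ih₂ =>
    obtain ⟨s, hs, hf, hd⟩ := ih₁
    obtain ⟨t, ht, hg, he⟩ := exists_finite_insert ih₂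
    exact ⟨s ∪ t, Set.union_subset_union hs ht, hf.union hg, hd.cut he⟩
  | andI hF _ _ ih₁ ih₂ =>
    obtain ⟨s, hs, hf, hd⟩ := ih₁
    obtain ⟨t, ht, hg, he⟩ := ih₂
    exact ⟨s ∪ t, Set.union_subset hs ht, hf.union hg,
      .andI hF (hd.weaken Set.subset_union_left) (he.weaken Set.subset_union_right)⟩
  | andE1 hF _ ih =>
    obtain ⟨s, hs, hf, hd⟩ := ih
    exact ⟨s, hs, hf, .andE1 hF hd⟩
  | andE2 hF _ ih =>
    obtain ⟨s, hs, hf, hd⟩ := ih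
    exact ⟨s, hs, hf, .andE2 hF hd⟩
  | orI hF _ _ ih₁ ih₂ =>
    obtain ⟨s, hs, hf, hd⟩ := exists_finite_insert ih₁
    obtain ⟨t, ht, hg, he⟩ := exists_finite_insert ih₂
    exact ⟨insert _ (s ∪ t), Set.insert_subset_insert (Set.union_subset hs ht),
      (hf.union hg).insert _,
      .orI hF (hd.weaken (Set.insert_subset_insert Set.subset_union_left))
        (he.weaken (Set.insert_subset_insert Set.subset_union_right))⟩
  | orE1 hF _ ih =>
    obtain ⟨s, hs, hf, hd⟩ := exists_finite_insert ih
    exact ⟨_, Set.insert_subset_insert hs, hf.insert _, .orE1 hF hd⟩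
  | orE2 hF _ ih =>
    obtain ⟨s, hs, hf, hd⟩ := exists_finite_insert ih
    exact ⟨_, Set.insert_subset_insert hs, hf.insert _, .orE2 hF hd⟩
  | impI hF _ ih =>
    obtain ⟨s, hs, hf, hd⟩ := exists_finite_insert ih
    exact ⟨s, hs, hf, .impI hF hd⟩
  | impE hF _ ih =>
    obtain ⟨s, hs, hf, hd⟩ := ih
    exact ⟨_, Set.insert_subset_insert hs, hf.insert _, .impE hF hd⟩
  | negI hF _ _ ih₁ ih₂ =>
    obtain ⟨s, hs, hf, hd⟩ := exists_finite_insert ih₁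
    obtain ⟨t, ht, hg, he⟩ := exists_finite_insert ih₂
    exact ⟨s ∪ t, Set.union_subset hs ht, hf.union hg,
      .negI hF (hd.weaken (Set.insert_subset_insert Set.subset_union_left))
        (he.weaken (Set.insert_subset_insert Set.subset_union_right))⟩
  | negE hF _ _ ih₁ ih₂ =>
    obtain ⟨s, hs, hf, hd⟩ := ih₁
    obtain ⟨t, ht, hg, he⟩ := ih₂
    exact ⟨s ∪ t, Set.union_subset hs ht, hf.union hg,
      .negE hF (hd.weaken Set.subset_union_left) (he.weaken Set.subset_union_right)⟩

/-- `Γ` is `F`-consistent: it does not derive any formula together with its negation. -/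
def Consistent (F : Set Conn) (Γ : Set PropForm) : Prop :=
  ¬ ∃ φ : PropForm, Deriv F Γ φ ∧ Deriv F Γ (.neg φ)

/-- Lindenbaum's lemma. -/
theorem Consistent.exists_maximal {F : Set Conn} {Γ : Set PropForm} (h : Consistent F Γ) :
    ∃ M, Γ ⊆ M ∧ Maximal (Consistent F) M := by
  refine zorn_subset_nonempty {Δ | Consistent F Δ} (fun c hc hchain hne => ?_) Γ h
  refine ⟨⋃₀ c, ?_, fun s hs => Set.subset_sUnion_of_mem hs⟩
  rintro ⟨φ, h₁, h₂⟩
  obtain ⟨s, hs, hf, hd⟩ := h₁.exists_finite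
  obtain ⟨t, ht, hg, he⟩ := h₂.exists_finite
  obtain ⟨Δ, hΔ, hsub⟩ := DirectedOn.exists_mem_subset_of_finite_of_subset_sUnion hne
    hchain.directedOn (hf.union hg) (Set.union_subset hs ht)
  exact hc hΔ ⟨φ, hd.weaken (Set.subset_union_left.trans hsub),
    he.weaken (Set.subset_union_right.trans hsub)⟩

section MaximalConsistent

variable {F : Set Conn} {M : Set PropForm} {φ ψ : PropForm}

theorem Maximal.mem_of_consistent_insert (hM : Maximal (Consistent F) M)
    (h : Consistent F (insert φ M)) : φ ∈ M :=
  hM.2 h (Set.subset_insert _ _) (Set.mem_insert _ _)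

theorem Maximal.mem_of_deriv (hM : Maximal (Consistent F) M) (h : Deriv F M φ) : φ ∈ M :=
  hM.mem_of_consistent_insert fun ⟨χ, h₁, h₂⟩ => hM.1 ⟨χ, h.cut_self h₁, h.cut_self h₂⟩

theorem Maximal.neg_mem_iff (hM : Maximal (Consistent F) M) (hF : Conn.nega ∈ F) :
    PropForm.neg φ ∈ M ↔ φ ∉ M := by
  refine ⟨fun hn hp => hM.1 ⟨φ, .mem hp, .mem hn⟩, fun hp => ?_⟩
  by_contra hn
  exact hp (hM.mem_of_consistent_insert fun ⟨χ, h₁, h₂⟩ =>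
    hn (hM.mem_of_deriv (.negI hF h₁ h₂)))

theorem Maximal.and_mem_iff (hM : Maximal (Consistent F) M) (hF : Conn.conj ∈ F) :
    PropForm.and φ ψ ∈ M ↔ φ ∈ M ∧ ψ ∈ M :=
  ⟨fun h => ⟨hM.mem_of_deriv (.andE1 hF (.mem h)), hM.mem_of_deriv (.andE2 hF (.mem h))⟩,
    fun h => hM.mem_of_deriv (.andI hF (.mem h.1) (.mem h.2))⟩

end MaximalConsistent

open Classical in
/-- A maximal `{∧,¬}`-consistent set is the set of `{∧,¬}`-formulas true under the Boolean
assignment given by the letters it contains. -/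
theorem evalBool_iff_mem_of_maximal {M : Set PropForm}
    (hM : Maximal (Consistent {Conn.conj, Conn.nega}) M) (ψ : PropForm)
    (hψ : InFrag {Conn.conj, Conn.nega} ψ) :
    evalBool (fun n => decide (PropForm.var n ∈ M)) ψ = true ↔ ψ ∈ M := by
  induction ψ with
  | var n => simp [evalBool]
  | and a b iha ihb =>
    simp only [InFrag, PropForm.conns, Set.insert_subset_iff, Set.union_subset_iff] at hψ iha ihb
    rw [hM.and_mem_iff (by simp), ← iha hψ.2.1, ← ihb hψ.2.2]
    simp [evalBool]
  | or a b => simp [InFrag, PropForm.conns, Set.insert_subset_iff] at hψ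
  | imp a b => simp [InFrag, PropForm.conns, Set.insert_subset_iff] at hψ
  | neg a iha =>
    simp only [InFrag, PropForm.conns, Set.insert_subset_iff] at hψ iha
    rw [hM.neg_mem_iff (by simp), ← iha hψ.2]
    simp [evalBool]

/-- if `Γ ⊆ 𝔉_{∧,¬}` is `{∧,¬}`-consistent, then `Γ` is classically
consistent. -/
theorem conj_neg_consistent_classical (Γ : Set PropForm)
    (hΓ : ∀ ψ ∈ Γ, InFrag {Conn.conj, Conn.nega} ψ)
    (hcons : ¬ ∃ φ : PropForm,
      Deriv {Conn.conj, Conn.nega} Γ φ ∧ Deriv {Conn.conj, Conn.nega} Γ (.neg φ)) :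
    ¬ ∃ φ : PropForm, ClassConseq Γ φ ∧ ClassConseq Γ (.neg φ) := by
  rintro ⟨φ, h₁, h₂⟩
  obtain ⟨M, hΓM, hM⟩ := Consistent.exists_maximal hcons
  have hv := fun ψ hψ => (evalBool_iff_mem_of_maximal hM ψ (hΓ ψ hψ)).2 (hΓM hψ)
  have hφ := h₁ _ hv
  have hn := h₂ _ hv
  simp [evalBool, hφ] at hn
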